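/- Let X be a nonsingular vector field on a closed, oriented smooth manifold M of dimension 2n+1, and let α, β be 1-forms on M that are invariant under the flow of X (L_X α = L_X β = 0) and satisfy α(X) = β(X) = 1. Then ∫_M α∧(dα)^n = ∫_M β∧(dβ)^n. -/

import Mathlib

open scoped BigOperators

/-- An abstract model of the calculus of smooth differential forms on a smooth
manifold `M`: `Ω` is the graded-commutative ℝ-algebra of smooth differential
forms on `M` (multiplication is the wedge product `∧`, and `1` is the constant
function `1`), `grade k` is the submodule of `k`-forms, `d` is the exterior
derivative, `dim` is the dimension of `M`, `VF` is the space of smooth vector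
fields on `M`, `iV X` is the interior product (contraction) with the vector
field `X`, `fn` assigns to a `0`-form the corresponding smooth real-valued
function on `M`, `NowhereZero ω` says that the differential form `ω` vanishes
nowhere on `M`, and `Nonsingular X` says that the vector field `X` has no
zeros.  The axioms are the standard rules of the exterior calculus. -/
structure SmoothCalculus (M : Type*) where
  /-- the differential forms on `M`, with the wedge product as multiplication -/
  Ω : Type*
  [ringΩ : Ring Ω]
  [algΩ : Algebra ℝ Ω]
  /-- the submodule of `k`-forms -/
  grade : ℕ → Submodule ℝ Ω
  /-- the exterior derivative -/
  d : Ω →ₗ[ℝ] Ω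
  /-- the dimension of the manifold `M` -/
  dim : ℕ
  /-- the smooth vector fields on `M` -/
  VF : Type*
  /-- the interior product (contraction) of a form with a vector field -/
  iV : VF → Ω →ₗ[ℝ] Ω
  /-- evaluation of a `0`-form as a real-valued function on `M` -/
  fn : Ω → M → ℝ
  /-- `NowhereZero ω`: the differential form `ω` is nowhere vanishing on `M` -/
  NowhereZero : Ω → Prop
  /-- `Nonsingular X`: the vector field `X` has no zeros -/
  Nonsingular : VF → Prop
  grade_d : ∀ {k : ℕ} {ω : Ω}, ω ∈ grade k → d ω ∈ grade (k + 1)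
  grade_mul : ∀ {k l : ℕ} {ω η : Ω}, ω ∈ grade k → η ∈ grade l → ω * η ∈ grade (k + l)
  one_mem_grade : (1 : Ω) ∈ grade 0
  grade_top : ∀ {k : ℕ}, dim < k → grade k = ⊥
  d_d : ∀ ω : Ω, d (d ω) = 0
  /-- the graded Leibniz rule for the exterior derivative -/
  leibniz : ∀ {k : ℕ} (ω η : Ω), ω ∈ grade k →
    d (ω * η) = d ω * η + ((-1 : ℝ) ^ k) • (ω * d η)
  /-- graded commutativity of the wedge product -/
  graded_comm : ∀ {k l : ℕ} (ω η : Ω), ω ∈ grade k → η ∈ grade l →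
    ω * η = ((-1 : ℝ) ^ (k * l)) • (η * ω)
  iV_grade : ∀ (X : VF) {k : ℕ} {ω : Ω}, ω ∈ grade (k + 1) → iV X ω ∈ grade k
  iV_grade_zero : ∀ (X : VF) {ω : Ω}, ω ∈ grade 0 → iV X ω = 0
  /-- the interior product is a graded antiderivation -/
  iV_mul : ∀ (X : VF) {k : ℕ} (ω η : Ω), ω ∈ grade k →
    iV X (ω * η) = iV X ω * η + ((-1 : ℝ) ^ k) • (ω * iV X η)
  fn_one : fn 1 = fun _ => 1

attribute [instance] SmoothCalculus.ringΩ SmoothCalculus.algΩ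

namespace SmoothCalculus

variable {M : Type*} (C : SmoothCalculus M)

/-- The Lie derivative of a differential form along a vector field, given by
Cartan's formula `L_X ω = i_X (dω) + d (i_X ω)`. -/
def lieD (X : C.VF) (ω : C.Ω) : C.Ω := C.iV X (C.d ω) + C.d (C.iV X ω)

/-- Integration of differential forms over the closed, oriented manifold `M`:
`integral ω` is the integral `∫_M ω` of (the top-degree part of) `ω`.  By
Stokes's theorem on a closed manifold, the integral of any exact form
vanishes. -/
structure OrientedIntegration where
  /-- the integral `∫_M` of (the top-degree part of) a differential form -/
  integral : C.Ω →ₗ[ℝ] ℝ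
  /-- Stokes's theorem on the closed manifold `M` -/
  integral_d : ∀ ω : C.Ω, integral (C.d ω) = 0

/-- A 1-form `α` is a characteristic 1-form of the vector field `X` if
`α(X) = 1` and `i_X dα = 0`. -/
def IsCharacteristic (X : C.VF) (α : C.Ω) : Prop :=
  α ∈ C.grade 1 ∧ C.iV X α = 1 ∧ C.iV X (C.d α) = 0

/-- A nonsingular vector field `X` is geodesible if there is a Riemannian
metric on `M` for which `X` has unit length and the flow lines of `X` are
geodesics; by the theorem of Wadsley and Sullivan this holds if and only if
`X` admits a characteristic 1-form, i.e. a 1-form `α` with `α(X) = 1` and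
`i_X dα = 0`, which is the characterisation used here. -/
def Geodesible (X : C.VF) : Prop := ∃ α, C.IsCharacteristic X α

/-- A differential form `ω` is basic for the foliation `⟨X⟩` spanned by `X` if
`i_X ω = 0` and `i_X dω = 0`. -/
def Basic (X : C.VF) (ω : C.Ω) : Prop := C.iV X ω = 0 ∧ C.iV X (C.d ω) = 0

end SmoothCalculus

open SmoothCalculus

namespace SmoothCalculus

section HorizontalForms

variable {M : Type*} {C : SmoothCalculus M}

theorem d_one : C.d 1 = 0 := by
  simpa using C.leibniz 1 1 C.one_mem_grade

/-- A form of even degree commutes with every homogeneous form. -/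
theorem commute_of_mem_grade_two_mul {k l : ℕ} {ω η : C.Ω} (hω : ω ∈ C.grade (2 * k))
    (hη : η ∈ C.grade l) : Commute ω η := by
  have h := C.graded_comm ω η hω hη
  rwa [mul_assoc, pow_mul, neg_one_sq, one_pow, one_smul] at h

/-- A form of degree `2 * k` that is closed and horizontal with respect to `X`. -/
def ClosedHorizontal (X : C.VF) (k : ℕ) (ω : C.Ω) : Prop :=
  ω ∈ C.grade (2 * k) ∧ C.d ω = 0 ∧ C.iV X ω = 0

theorem ClosedHorizontal.one (X : C.VF) : ClosedHorizontal X 0 (1 : C.Ω) :=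
  ⟨C.one_mem_grade, d_one, C.iV_grade_zero X C.one_mem_grade⟩

theorem ClosedHorizontal.mul {X : C.VF} {k l : ℕ} {ω η : C.Ω} (hω : ClosedHorizontal X k ω)
    (hη : ClosedHorizontal X l η) : ClosedHorizontal X (k + l) (ω * η) := by
  refine ⟨?_, ?_, ?_⟩
  · rw [mul_add]
    exact C.grade_mul hω.1 hη.1
  · rw [C.leibniz _ _ hω.1, hω.2.1, hη.2.1]
    simp
  · rw [C.iV_mul X _ _ hω.1, hω.2.2, hη.2.2]
    simp

theorem ClosedHorizontal.pow {X : C.VF} {ω : C.Ω} (hω : ClosedHorizontal X 1 ω) (k : ℕ) :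
    ClosedHorizontal X k (ω ^ k) := by
  induction k with
  | zero => simpa using ClosedHorizontal.one X
  | succ k ih => simpa [pow_succ] using ih.mul hω

/-- The differential of an invariant 1-form `α` with `α(X) = 1` is closed and horizontal. -/
theorem closedHorizontal_d {X : C.VF} {α : C.Ω} (hα : α ∈ C.grade 1) (hL : C.lieD X α = 0)
    (hX : C.iV X α = 1) : ClosedHorizontal X 1 (C.d α) := by
  refine ⟨C.grade_d hα, C.d_d α, ?_⟩
  simpa [lieD, hX, d_one] using hL

/-- A horizontal form of top degree vanishes. -/
theorem eq_zero_of_iV_eq_zero {X : C.VF} {α ω : C.Ω} {k : ℕ} (hα : α ∈ C.grade 1)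
    (hX : C.iV X α = 1) (hk : C.dim ≤ k) (hω : ω ∈ C.grade k) (h : C.iV X ω = 0) : ω = 0 := by
  have hz : α * ω = 0 := by
    have hm := C.grade_mul hα hω
    rwa [C.grade_top (by lia), Submodule.mem_bot] at hm
  have hi := C.iV_mul X α ω hα
  simpa [hz, hX, h] using hi.symm

/-- The product of a horizontal 1-form and a closed horizontal `2 * n`-form vanishes in
dimension `2 * n + 1`. -/
theorem ClosedHorizontal.mul_eq_zero {X : C.VF} {α γ ω : C.Ω} {n : ℕ}
    (hω : ClosedHorizontal X n ω) (hdim : C.dim = 2 * n + 1) (hα : α ∈ C.grade 1)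
    (hX : C.iV X α = 1) (hγ : γ ∈ C.grade 1) (hγX : C.iV X γ = 0) : γ * ω = 0 := by
  refine eq_zero_of_iV_eq_zero hα hX (k := 1 + 2 * n) (by lia) (C.grade_mul hγ hω.1) ?_
  rw [C.iV_mul X _ _ hγ, hγX, hω.2.2]
  simp

/-- Integration by parts against a closed horizontal form. -/
theorem OrientedIntegration.integral_mul_d_mul_eq_zero (I : C.OrientedIntegration) {X : C.VF}
    {β γ ω : C.Ω} {n : ℕ} (hω : ClosedHorizontal X n ω) (hdim : C.dim = 2 * (n + 1) + 1)
    (hβ : β ∈ C.grade 1) (hβX : C.iV X β = 1) (hdβ : ClosedHorizontal X 1 (C.d β))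
    (hγ : γ ∈ C.grade 1) (hγX : C.iV X γ = 0) :
    I.integral (β * (C.d γ * ω)) = 0 := by
  have hz : C.d β * (γ * ω) = 0 := by
    rw [← mul_assoc, (commute_of_mem_grade_two_mul (k := 1) hdβ.1 hγ).eq, mul_assoc]
    refine (hdβ.mul hω).mul_eq_zero ?_ hβ hβX hγ hγX
    rw [hdim, add_comm 1 n]
  have h := I.integral_d (β * (γ * ω))
  rw [C.leibniz _ _ hβ, C.leibniz _ _ hγ, hω.2.1, hz] at h
  simpa using h

end HorizontalForms

end SmoothCalculus

/-- **Croke–Kleiner.**  Let `X` be a nonsingular vector field on a closed,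
oriented manifold `M` of dimension `2n+1`, and let `α`, `β` be 1-forms on `M`
invariant under the flow of `X` (`L_X α = L_X β = 0`) with `α(X) = β(X) = 1`.
Then `∫_M α∧(dα)ⁿ = ∫_M β∧(dβ)ⁿ`. -/
theorem croke_kleiner {M : Type*} [TopologicalSpace M] [CompactSpace M]
    (C : SmoothCalculus M) (I : C.OrientedIntegration) {n : ℕ} (hdim : C.dim = 2 * n + 1)
    (X : C.VF) (hX : C.Nonsingular X)
    {α β : C.Ω} (hα : α ∈ C.grade 1) (hβ : β ∈ C.grade 1)
    (hLα : C.lieD X α = 0) (hLβ : C.lieD X β = 0)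
    (hαX : C.iV X α = 1) (hβX : C.iV X β = 1) :
    I.integral (α * (C.d α) ^ n) = I.integral (β * (C.d β) ^ n) := by
  have hA := closedHorizontal_d hα hLα hαX
  have hB := closedHorizontal_d hβ hLβ hβX
  have hγ : α - β ∈ C.grade 1 := Submodule.sub_mem _ hα hβ
  have hγX : C.iV X (α - β) = 0 := by rw [map_sub, hαX, hβX, sub_self]
  have hαβ : α * C.d α ^ n = β * C.d α ^ n := by
    rw [← sub_eq_zero, ← sub_mul]
    exact (hA.pow n).mul_eq_zero hdim hα hαX hγ hγX
  have key : ∀ i j : ℕ, i + j = n →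
      I.integral (β * (C.d α ^ i * C.d β ^ j)) = I.integral (β * C.d β ^ n) := by
    intro i
    induction i with
    | zero =>
      rintro j rfl
      simp
    | succ i ih =>
      intro j hij
      rw [← ih (j + 1) (by lia), ← sub_eq_zero, ← map_sub, ← mul_sub]
      have hsub : C.d α ^ (i + 1) * C.d β ^ j - C.d α ^ i * C.d β ^ (j + 1) =
          C.d (α - β) * (C.d α ^ i * C.d β ^ j) := by
        have hc := (commute_of_mem_grade_two_mul (k := 1) hB.1 (hA.pow i).1).eq
        rw [map_sub, sub_mul, pow_succ', pow_succ', mul_assoc, ← mul_assoc (C.d β), hc, mul_assoc]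
      rw [hsub]
      exact I.integral_mul_d_mul_eq_zero ((hA.pow i).mul (hB.pow j)) (by lia) hβ hβX hB hγ hγX
  rw [hαβ, ← key n 0 (add_zero n), pow_zero, mul_one]
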